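/- Let A = kQ/I be a (locally) gentle algebra. The center Z(A) is generated as a k-algebra by: (1) the identity 1 = Σ_{v∈Q0} ε_v; (2) the finite maximal paths γ ∈ B that are cycles in Q; and (3) the elements m_γ for each infinite maximal path γ of A. Moreover, the elements of types (1) and (2) together with all positive powers of the elements of type (3) form a k-basis of Z(A). -/

import Mathlib

/- Common framework for (locally) gentle algebras -/

noncomputable section
open scoped BigOperators
open CategoryTheory

namespace LocGentle

/-- A finite connected quiver with at least one vertex and one arrow. -/
structure Quiv where
  V : Type
  Arr : Type
  [fintypeV : Fintype V]
  [fintypeA : Fintype Arr]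
  [decEqV : DecidableEq V]
  [decEqA : DecidableEq Arr]
  src : Arr → V
  tgt : Arr → V
  [nonemptyV : Nonempty V]
  [nonemptyA : Nonempty Arr]
  connected : (SimpleGraph.fromRel (fun v w => ∃ a, src a = v ∧ tgt a = w)).Connected

attribute [instance] Quiv.fintypeV Quiv.fintypeA Quiv.decEqV Quiv.decEqA
  Quiv.nonemptyV Quiv.nonemptyA

variable (Q : Quiv)

/-- in-degree of a vertex -/
def indeg (v : Q.V) : ℕ := (Finset.univ.filter (fun a => Q.tgt a = v)).card

/-- out-degree of a vertex -/
def outdeg (v : Q.V) : ℕ := (Finset.univ.filter (fun a => Q.src a = v)).card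

/-- a list of arrows is composable (forms a path) -/
def Composable (l : List Q.Arr) : Prop := l.Chain' (fun a b => Q.tgt a = Q.src b)

variable {Q}

/-- source vertex of a nonempty word -/
def wSrc? (l : List Q.Arr) : Option Q.V := l.head?.map Q.src

/-- target vertex of a nonempty word -/
def wTgt? (l : List Q.Arr) : Option Q.V := l.getLast?.map Q.tgt

/-- target of a word, with a default value (used for stationary paths) -/
def wTgtD (l : List Q.Arr) (v : Q.V) : Q.V := (l.getLast?.map Q.tgt).getD v

/-- last arrow of a word, with a (junk) default -/
def wLast (l : List Q.Arr) : Q.Arr := l.getLast?.getD (Classical.arbitrary _)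

variable (rel : Q.Arr → Q.Arr → Prop)

/-- A word is allowed (is a basis path of `A = kQ/I`) if consecutive arrows are
composable and no consecutive pair lies in the relation set generating `I`. -/
def AllowedWord (l : List Q.Arr) : Prop :=
  l.Chain' (fun a b => Q.tgt a = Q.src b ∧ ¬ rel a b)

/-- right maximal paths (of positive length) -/
def RightMaxWord (l : List Q.Arr) : Prop :=
  l ≠ [] ∧ AllowedWord rel l ∧ ∀ a : Q.Arr, ¬ AllowedWord rel (l ++ [a])

/-- left maximal paths (of positive length) -/
def LeftMaxWord (l : List Q.Arr) : Prop :=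
  l ≠ [] ∧ AllowedWord rel l ∧ ∀ a : Q.Arr, ¬ AllowedWord rel (a :: l)

/-- finite maximal paths -/
def FiniteMaxWord (l : List Q.Arr) : Prop := RightMaxWord rel l ∧ LeftMaxWord rel l

/-- a word is primitive if it is not a proper power -/
def PrimitiveWord (l : List Q.Arr) : Prop :=
  ∀ (l' : List Q.Arr) (n : ℕ), 2 ≤ n → l ≠ (List.replicate n l').flatten

/-- a primitive cycle `c` with `c² ∉ I`; these represent the infinite maximal paths `c^∞`. -/
def PrimCycleSq (c : List Q.Arr) : Prop :=
  c ≠ [] ∧ AllowedWord rel (c ++ c) ∧ wTgt? c = wSrc? c ∧ PrimitiveWord c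

/-- the maximal path `γ_α` containing `α` is infinite -/
def InfThrough (a : Q.Arr) : Prop := ∃ c, PrimCycleSq rel c ∧ a ∈ c

/-- the maximal path `γ_α` containing `α` is finite -/
def FinThrough (a : Q.Arr) : Prop := ∃ l, FiniteMaxWord rel l ∧ a ∈ l

/-- the rotation of the cycle `c` starting at the arrow `a`; when `a ∈ c` and `c` has no
duplicates this is the primitive cycle `γ_r(a)`. -/
def rotTo (c : List Q.Arr) (a : Q.Arr) : List Q.Arr :=
  c.dropWhile (fun b => b != a) ++ c.takeWhile (fun b => b != a)

/-- the relation set of the Koszul dual `A#`; its allowed words are the forbidden paths of `A`. -/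
def dualRel : Q.Arr → Q.Arr → Prop := fun a b => Q.tgt a = Q.src b ∧ ¬ rel a b

/-- a forbidden path of `A`, i.e. a path of the Koszul dual `A#` -/
def ForbiddenWord (l : List Q.Arr) : Prop := AllowedWord (dualRel rel) l

variable (Q)

/-- The defining conditions (i)-(iv) of a (locally) gentle algebra, in terms of the set of
length-two relations generating the ideal `I`: an algebra satisfying them is gentle if it
is finite dimensional and locally gentle otherwise. -/
structure IsGentleRel : Prop where
  indeg_le : ∀ v : Q.V, indeg Q v ≤ 2
  outdeg_le : ∀ v : Q.V, outdeg Q v ≤ 2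
  rel_comp : ∀ a b : Q.Arr, rel a b → Q.tgt a = Q.src b
  cond_ii : ∀ a b b' : Q.Arr, b ≠ b' → Q.tgt b = Q.src a → Q.tgt b' = Q.src a →
    Xor' (rel b a) (rel b' a)
  cond_iii : ∀ a b b' : Q.Arr, b ≠ b' → Q.tgt a = Q.src b → Q.tgt a = Q.src b' →
    Xor' (rel a b) (rel a b')

/-- `Q` is (as a quiver) the extended Dynkin quiver `Ã_n` (for `n = |Q₀| - 1`):
every vertex has in-degree and out-degree one. -/
def IsAtilde : Prop := ∀ v : Q.V, indeg Q v = 1 ∧ outdeg Q v = 1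

/-- paths of `Q`, including the stationary paths (`w = []`) at each vertex -/
structure Pth where
  s : Q.V
  w : List Q.Arr
  hs : ∀ a ∈ w.head?, Q.src a = s
  hc : Composable Q w

variable {Q}

/-- target of a path -/
def Pth.t (p : Pth Q) : Q.V := wTgtD p.w p.s

/-- length of a path -/
def Pth.len (p : Pth Q) : ℕ := p.w.length

/-- a basis path of `A = kQ/I` -/
def Pth.Allowed (p : Pth Q) : Prop := AllowedWord rel p.w

end LocGentle
namespace LocGentle

variable (k : Type) [Field k] (Q : Quiv) (rel : Q.Arr → Q.Arr → Prop)

/-- The defining relations presenting `A = kQ/I` as a quotient of the free algebra on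
the stationary paths (vertices) and arrows: the path algebra relations together with
the relations `αβ = 0` for the length-two paths `αβ` generating `I`. -/
inductive GARel : FreeAlgebra k (Q.V ⊕ Q.Arr) → FreeAlgebra k (Q.V ⊕ Q.Arr) → Prop
  | idem (v : Q.V) : GARel (FreeAlgebra.ι k (Sum.inl v) * FreeAlgebra.ι k (Sum.inl v))
      (FreeAlgebra.ι k (Sum.inl v))
  | orth (v w : Q.V) : v ≠ w → GARel (FreeAlgebra.ι k (Sum.inl v) * FreeAlgebra.ι k (Sum.inl w)) 0
  | unit : GARel (∑ v : Q.V, FreeAlgebra.ι k (Sum.inl v)) 1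
  | src_mul (a : Q.Arr) : GARel (FreeAlgebra.ι k (Sum.inl (Q.src a)) * FreeAlgebra.ι k (Sum.inr a))
      (FreeAlgebra.ι k (Sum.inr a))
  | mul_tgt (a : Q.Arr) : GARel (FreeAlgebra.ι k (Sum.inr a) * FreeAlgebra.ι k (Sum.inl (Q.tgt a)))
      (FreeAlgebra.ι k (Sum.inr a))
  | src_zero (v : Q.V) (a : Q.Arr) : v ≠ Q.src a →
      GARel (FreeAlgebra.ι k (Sum.inl v) * FreeAlgebra.ι k (Sum.inr a)) 0
  | tgt_zero (v : Q.V) (a : Q.Arr) : v ≠ Q.tgt a →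
      GARel (FreeAlgebra.ι k (Sum.inr a) * FreeAlgebra.ι k (Sum.inl v)) 0
  | rel_zero (a b : Q.Arr) : rel a b →
      GARel (FreeAlgebra.ι k (Sum.inr a) * FreeAlgebra.ι k (Sum.inr b)) 0

/-- The (locally) gentle algebra `A = kQ/I`. -/
abbrev GA := RingQuot (GARel k Q rel)

/-- the image in `A` of the stationary path at `v` -/
def vtx (v : Q.V) : GA k Q rel := RingQuot.mkAlgHom k _ (FreeAlgebra.ι k (Sum.inl v))

/-- the image in `A` of the arrow `a` -/
def arr (a : Q.Arr) : GA k Q rel := RingQuot.mkAlgHom k _ (FreeAlgebra.ι k (Sum.inr a))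

/-- the image in `A` of the word `l` (the product of its arrows) -/
def wordEl (l : List Q.Arr) : GA k Q rel := (l.map (arr k Q rel)).prod

variable {Q}

/-- the image in `A` of a path (a stationary path maps to the corresponding idempotent) -/
def Pth.el (p : Pth Q) : GA k Q rel := vtx k Q rel p.s * wordEl k Q rel p.w

variable (Q)

/-- the `n`-th graded component `A_n` of `A`, spanned by the images of paths of length `n` -/
def deg (n : ℕ) : Submodule k (GA k Q rel) :=
  Submodule.span k {x | ∃ p : Pth Q, p.Allowed rel ∧ p.len = n ∧ x = p.el k rel}

/-- the augmentation ideal `A₊` (as a `k`-submodule), spanned by paths of positive length -/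
def degPlus : Submodule k (GA k Q rel) :=
  Submodule.span k {x | ∃ p : Pth Q, p.Allowed rel ∧ 1 ≤ p.len ∧ x = p.el k rel}

/-- the Hilbert series of `A` (with integer coefficients) -/
def hilb : PowerSeries ℤ :=
  PowerSeries.mk fun n => (Module.finrank k (deg k Q rel n) : ℤ)

/-- the Hilbert series of `A` (with rational coefficients) -/
def hilbQ : PowerSeries ℚ :=
  PowerSeries.mk fun n => (Module.finrank k (deg k Q rel n) : ℚ)

/-- the number `k_n` of finite maximal paths of length at least `n` -/
def numFMP (n : ℕ) : ℕ := {l : List Q.Arr | FiniteMaxWord rel l ∧ n ≤ l.length}.ncard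

/-- the Gelfand-Kirillov dimension of `A`:
`limsup_n log (dim_k A_{≤ n}) / log n`. -/
def GKdim : ℝ :=
  Filter.limsup (fun n : ℕ =>
      Real.log (Module.finrank k ↥(⨆ i ∈ Finset.range (n + 1), deg k Q rel i)) / Real.log n)
    Filter.atTop

/-- the central element `m_γ` attached to the infinite maximal path `γ = c^∞`:
the sum over the arrows `α` of `c` of the primitive cycle `γ_r(α)` starting at `α`. -/
def mEl (c : List Q.Arr) : GA k Q rel := (c.map fun a => wordEl k Q rel (rotTo c a)).sum

/-- evaluation of a polynomial at `x ∈ A`; `polyEval k Q rel p x` is `p(x)`. -/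
def polyEval (p : Polynomial k) (x : GA k Q rel) : GA k Q rel :=
  Polynomial.eval₂ (algebraMap k (GA k Q rel)) x p

end LocGentle
namespace LocGentle

section Generators

variable {k : Type} [Field k] {Q : Quiv} {rel : Q.Arr → Q.Arr → Prop}

theorem vtx_mul_self (v : Q.V) : vtx k Q rel v * vtx k Q rel v = vtx k Q rel v := by
  simpa [vtx] using RingQuot.mkAlgHom_rel k (GARel.idem (k := k) (rel := rel) v)

theorem vtx_mul_of_ne {v w : Q.V} (h : v ≠ w) : vtx k Q rel v * vtx k Q rel w = 0 := by
  simpa [vtx] using RingQuot.mkAlgHom_rel k (GARel.orth (k := k) (rel := rel) v w h)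

theorem sum_vtx : ∑ v : Q.V, vtx k Q rel v = 1 := by
  simpa [vtx] using RingQuot.mkAlgHom_rel k (GARel.unit (k := k) (rel := rel))

theorem vtx_src_mul_arr (a : Q.Arr) :
    vtx k Q rel (Q.src a) * arr k Q rel a = arr k Q rel a := by
  simpa [vtx, arr] using RingQuot.mkAlgHom_rel k (GARel.src_mul (k := k) (rel := rel) a)

theorem arr_mul_vtx_tgt (a : Q.Arr) :
    arr k Q rel a * vtx k Q rel (Q.tgt a) = arr k Q rel a := by
  simpa [vtx, arr] using RingQuot.mkAlgHom_rel k (GARel.mul_tgt (k := k) (rel := rel) a)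

theorem vtx_mul_arr_of_ne {v : Q.V} {a : Q.Arr} (h : v ≠ Q.src a) :
    vtx k Q rel v * arr k Q rel a = 0 := by
  simpa [vtx, arr] using RingQuot.mkAlgHom_rel k (GARel.src_zero (k := k) (rel := rel) v a h)

theorem arr_mul_vtx_of_ne {v : Q.V} {a : Q.Arr} (h : v ≠ Q.tgt a) :
    arr k Q rel a * vtx k Q rel v = 0 := by
  simpa [vtx, arr] using RingQuot.mkAlgHom_rel k (GARel.tgt_zero (k := k) (rel := rel) v a h)

theorem arr_mul_arr_of_not_dualRel {a b : Q.Arr} (h : ¬ dualRel rel a b) :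
    arr k Q rel a * arr k Q rel b = 0 := by
  by_cases hc : Q.tgt a = Q.src b
  · have hr : rel a b := by
      by_contra hn
      exact h ⟨hc, hn⟩
    simpa [arr] using RingQuot.mkAlgHom_rel k (GARel.rel_zero (k := k) a b hr)
  · rw [← vtx_src_mul_arr b, ← mul_assoc, arr_mul_vtx_of_ne (fun h => hc h.symm), zero_mul]

@[simp] theorem wordEl_nil : wordEl k Q rel [] = 1 := by simp [wordEl]

@[simp] theorem wordEl_cons (a : Q.Arr) (l : List Q.Arr) :
    wordEl k Q rel (a :: l) = arr k Q rel a * wordEl k Q rel l := by simp [wordEl]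

@[simp] theorem wordEl_append (l l' : List Q.Arr) :
    wordEl k Q rel (l ++ l') = wordEl k Q rel l * wordEl k Q rel l' := by simp [wordEl]

theorem allowedWord_cons {a : Q.Arr} {l : List Q.Arr} :
    AllowedWord rel (a :: l) ↔ (∀ b ∈ l.head?, dualRel rel a b) ∧ AllowedWord rel l :=
  List.isChain_cons

theorem allowedWord_append {l l' : List Q.Arr} :
    AllowedWord rel (l ++ l') ↔ AllowedWord rel l ∧ AllowedWord rel l' ∧
      ∀ a ∈ l.getLast?, ∀ b ∈ l'.head?, dualRel rel a b :=
  List.isChain_append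

theorem wordEl_of_not_allowedWord {l : List Q.Arr} (h : ¬ AllowedWord rel l) :
    wordEl k Q rel l = 0 := by
  induction l with
  | nil => exact absurd List.isChain_nil h
  | cons a l ih =>
    by_cases hl : AllowedWord rel l
    · cases l with
      | nil => exact absurd (List.isChain_singleton a) h
      | cons b l =>
        have : ¬ dualRel rel a b := fun hd => h (allowedWord_cons.2 ⟨by simpa using hd, hl⟩)
        rw [wordEl_cons, wordEl_cons, ← mul_assoc, arr_mul_arr_of_not_dualRel this, zero_mul]
    · rw [wordEl_cons, ih hl, mul_zero]

theorem vtx_mul_wordEl {l : List Q.Arr} {a : Q.Arr} (ha : a ∈ l.head?) (v : Q.V) :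
    vtx k Q rel v * wordEl k Q rel l = if Q.src a = v then wordEl k Q rel l else 0 := by
  cases l with
  | nil => simp at ha
  | cons b l =>
    obtain rfl : b = a := by simpa using ha
    split_ifs with h
    · rw [wordEl_cons, ← mul_assoc, ← h, vtx_src_mul_arr]
    · rw [wordEl_cons, ← mul_assoc, vtx_mul_arr_of_ne (Ne.symm h), zero_mul]

theorem wordEl_mul_vtx {l : List Q.Arr} {a : Q.Arr} (ha : a ∈ l.getLast?) (v : Q.V) :
    wordEl k Q rel l * vtx k Q rel v = if Q.tgt a = v then wordEl k Q rel l else 0 := by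
  obtain ⟨l, rfl⟩ := List.mem_getLast?_eq_getLast ha |>.elim
    fun h e => (⟨l.dropLast, by rw [e, List.dropLast_append_getLast]⟩ : ∃ l', l = l' ++ [a])
  simp only [wordEl_append, wordEl_cons, wordEl_nil, mul_one, mul_assoc]
  split_ifs with h
  · rw [← h, arr_mul_vtx_tgt]
  · rw [arr_mul_vtx_of_ne (Ne.symm h), mul_zero]

theorem subalgebra_eq_top (S : Subalgebra k (GA k Q rel)) (hv : ∀ v, vtx k Q rel v ∈ S)
    (ha : ∀ a, arr k Q rel a ∈ S) : S = ⊤ := by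
  refine top_unique fun x hx => ?_
  obtain ⟨y, rfl⟩ := RingQuot.mkAlgHom_surjective k (GARel k Q rel) x
  clear hx
  induction y using FreeAlgebra.induction with
  | grade0 r => rw [AlgHom.commutes]; exact S.algebraMap_mem r
  | grade1 x => cases x with
    | inl v => exact hv v
    | inr a => exact ha a
  | mul a b iha ihb => rw [map_mul]; exact S.mul_mem iha ihb
  | add a b iha ihb => rw [map_add]; exact S.add_mem iha ihb

theorem mem_center_iff_commute_generators {x : GA k Q rel} :
    x ∈ Subalgebra.center k (GA k Q rel) ↔
      (∀ v, vtx k Q rel v * x = x * vtx k Q rel v) ∧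
        ∀ a, arr k Q rel a * x = x * arr k Q rel a := by
  rw [Subalgebra.mem_center_iff]
  refine ⟨fun h => ⟨fun v => h _, fun a => h _⟩, fun ⟨hv, ha⟩ b => ?_⟩
  have hS := subalgebra_eq_top (Subalgebra.centralizer k {x})
    (fun v => Subalgebra.mem_centralizer_iff k |>.2 (by simpa using (hv v).symm))
    (fun a => Subalgebra.mem_centralizer_iff k |>.2 (by simpa using (ha a).symm))
  have hb : b ∈ Subalgebra.centralizer k {x} := hS ▸ Algebra.mem_top
  exact ((Subalgebra.mem_centralizer_iff k).1 hb x rfl).symm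

end Generators

section PathBasis

open Classical

variable (k : Type) [Field k] {Q : Quiv} (rel : Q.Arr → Q.Arr → Prop)

/-- The pairs `(v, l)` naming a path: nontrivial paths `l` with `v` their source, and the
stationary path `(v, [])`. -/
def ValidPath (p : Q.V × List Q.Arr) : Prop :=
  AllowedWord rel p.2 ∧ ∀ a ∈ p.2.head?, Q.src a = p.1

/-- The element of `A` named by a pair `(v, l)`; it is zero unless the pair is a valid path. -/
def pathEl (p : Q.V × List Q.Arr) : GA k Q rel := vtx k Q rel p.1 * wordEl k Q rel p.2

/-- The linear combination of paths with given coefficients. -/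
def ofCoeff : (Q.V × List Q.Arr →₀ k) →ₗ[k] GA k Q rel :=
  Finsupp.linearCombination k (pathEl k rel)

/-- Left multiplication by a stationary path, on coefficients. -/
def vtxOp (v : Q.V) : Module.End k (Q.V × List Q.Arr →₀ k) :=
  Finsupp.linearCombination k fun p => if p.1 = v then Finsupp.single p 1 else 0

/-- Left multiplication by an arrow, on coefficients. -/
def arrOp (a : Q.Arr) : Module.End k (Q.V × List Q.Arr →₀ k) :=
  Finsupp.linearCombination k fun p =>
    if p.1 = Q.tgt a ∧ AllowedWord rel (a :: p.2) then Finsupp.single (Q.src a, a :: p.2) 1 else 0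

variable {k rel}

theorem pathEl_of_not_validPath {p : Q.V × List Q.Arr} (h : ¬ ValidPath rel p) :
    pathEl k rel p = 0 := by
  unfold pathEl
  by_cases ha : AllowedWord rel p.2
  · simp only [ValidPath, ha, true_and, not_forall] at h
    obtain ⟨a, ha, hs⟩ := h
    rw [vtx_mul_wordEl ha, if_neg hs]
  · rw [wordEl_of_not_allowedWord ha, mul_zero]

@[simp] theorem ofCoeff_single (p : Q.V × List Q.Arr) (r : k) :
    ofCoeff k rel (Finsupp.single p r) = r • pathEl k rel p := by simp [ofCoeff]

@[simp] theorem vtxOp_single (v : Q.V) (p : Q.V × List Q.Arr) (r : k) :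
    vtxOp k v (Finsupp.single p r) = if p.1 = v then Finsupp.single p r else 0 := by
  simp [vtxOp]

@[simp] theorem arrOp_single (a : Q.Arr) (p : Q.V × List Q.Arr) (r : k) :
    arrOp k rel a (Finsupp.single p r) = if p.1 = Q.tgt a ∧ AllowedWord rel (a :: p.2) then
      Finsupp.single (Q.src a, a :: p.2) r else 0 := by
  simp [arrOp]

variable (k rel) in
/-- The action of `A` on coefficients by left multiplication. -/
def leftAction : GA k Q rel →ₐ[k] Module.End k (Q.V × List Q.Arr →₀ k) :=
  RingQuot.liftAlgHom k ⟨FreeAlgebra.lift k (Sum.elim (vtxOp k) (arrOp k rel)), by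
    intro x y h
    induction h with
    | idem v =>
      ext p : 2
      by_cases h : p.1 = v <;> simp [h]
    | orth v w hvw =>
      ext p : 2
      by_cases h : p.1 = w <;> simp [h, hvw.symm]
    | unit =>
      ext p : 2
      simp
    | src_mul a =>
      ext p : 2
      by_cases h : p.1 = Q.tgt a ∧ AllowedWord rel (a :: p.2) <;> simp [h]
    | mul_tgt a =>
      ext p : 2
      by_cases h : p.1 = Q.tgt a <;> simp [h]
    | src_zero v a hv =>
      ext p : 2
      by_cases h : p.1 = Q.tgt a ∧ AllowedWord rel (a :: p.2) <;> simp [h, hv.symm]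
    | tgt_zero v a hv =>
      ext p : 2
      by_cases h : p.1 = v <;> simp [h, hv]
    | rel_zero a b hr =>
      ext p : 2
      have : ∀ l, ¬ AllowedWord rel (a :: b :: l) := fun l h =>
        ((allowedWord_cons.1 h).1 b rfl).2 hr
      by_cases h : p.1 = Q.tgt b ∧ AllowedWord rel (b :: p.2) <;> simp [h, this]⟩

@[simp] theorem leftAction_vtx (v : Q.V) : leftAction k rel (vtx k Q rel v) = vtxOp k v := by
  simp [leftAction, vtx]

@[simp] theorem leftAction_arr (a : Q.Arr) : leftAction k rel (arr k Q rel a) = arrOp k rel a := by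
  simp [leftAction, arr]

theorem vtx_mul_pathEl (v : Q.V) (p : Q.V × List Q.Arr) :
    vtx k Q rel v * pathEl k rel p = if p.1 = v then pathEl k rel p else 0 := by
  unfold pathEl
  split_ifs with h
  · rw [← mul_assoc, h, vtx_mul_self]
  · rw [← mul_assoc, vtx_mul_of_ne (Ne.symm h), zero_mul]

theorem arr_mul_pathEl (a : Q.Arr) (p : Q.V × List Q.Arr) :
    arr k Q rel a * pathEl k rel p =
      if p.1 = Q.tgt a then pathEl k rel (Q.src a, a :: p.2) else 0 := by
  unfold pathEl
  split_ifs with h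
  · rw [h, wordEl_cons, ← mul_assoc, ← mul_assoc, arr_mul_vtx_tgt, vtx_src_mul_arr]
  · rw [← mul_assoc, arr_mul_vtx_of_ne h, zero_mul]

theorem pathEl_mul_arr (a : Q.Arr) (p : Q.V × List Q.Arr) :
    pathEl k rel p * arr k Q rel a = pathEl k rel (p.1, p.2 ++ [a]) := by
  simp [pathEl, mul_assoc]

theorem ofCoeff_leftAction (x : GA k Q rel) (m : Q.V × List Q.Arr →₀ k) :
    ofCoeff k rel (leftAction k rel x m) = x * ofCoeff k rel m := by
  let S : Subalgebra k (GA k Q rel) :=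
    { carrier := {x | ∀ m, ofCoeff k rel (leftAction k rel x m) = x * ofCoeff k rel m}
      mul_mem' := fun {x y} hx hy m => by
        rw [map_mul, Module.End.mul_apply, hx, hy, mul_assoc]
      add_mem' := fun {x y} hx hy m => by
        rw [map_add, LinearMap.add_apply, map_add, hx, hy, add_mul]
      algebraMap_mem' := fun r m => by
        simp [Algebra.smul_def] }
  have hS : S = ⊤ := by
    apply subalgebra_eq_top
    · intro v m
      induction m using Finsupp.induction_linear with
      | zero => simp
      | add f g hf hg => simp only [map_add, mul_add, hf, hg]
      | single p r =>
        rw [leftAction_vtx, vtxOp_single, ofCoeff_single, mul_smul_comm, vtx_mul_pathEl]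
        split_ifs <;> simp
    · intro a m
      induction m using Finsupp.induction_linear with
      | zero => simp
      | add f g hf hg => simp only [map_add, mul_add, hf, hg]
      | single p r =>
        rw [leftAction_arr, arrOp_single, ofCoeff_single, mul_smul_comm, arr_mul_pathEl]
        by_cases h : p.1 = Q.tgt a
        · by_cases h' : AllowedWord rel (a :: p.2)
          · simp [h, h']
          · simp [h, h', pathEl_of_not_validPath (p := (Q.src a, a :: p.2)) (fun hv => h' hv.1)]
        · simp [h]
  have hx : x ∈ S := hS ▸ Algebra.mem_top
  exact hx m

variable (k rel) in
/-- The coefficients of an element of `A` in the basis of paths. -/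
def coeff : GA k Q rel →ₗ[k] (Q.V × List Q.Arr →₀ k) where
  toFun x := leftAction k rel x (∑ v, Finsupp.single (v, []) 1)
  map_add' x y := by rw [map_add, LinearMap.add_apply]
  map_smul' r x := by rw [map_smul, LinearMap.smul_apply, RingHom.id_apply]

theorem ofCoeff_coeff (x : GA k Q rel) : ofCoeff k rel (coeff k rel x) = x := by
  change ofCoeff k rel (leftAction k rel x _) = x
  rw [ofCoeff_leftAction, map_sum]
  simp [pathEl, sum_vtx]

theorem coeff_mul (x y : GA k Q rel) :
    coeff k rel (x * y) = leftAction k rel x (coeff k rel y) := by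
  simp [coeff]

theorem coeff_pathEl (p : Q.V × List Q.Arr) :
    coeff k rel (pathEl k rel p) = if ValidPath rel p then Finsupp.single p 1 else 0 := by
  split_ifs with h
  swap
  · rw [pathEl_of_not_validPath h, map_zero]
  obtain ⟨v, l⟩ := p
  induction l generalizing v with
  | nil =>
    change leftAction k rel (pathEl k rel (v, [])) _ = _
    simp [pathEl]
  | cons a l ih =>
    obtain rfl : Q.src a = v := h.2 a rfl
    have hl : ValidPath rel (Q.tgt a, l) :=
      ⟨(allowedWord_cons.1 h.1).2, fun b hb => ((allowedWord_cons.1 h.1).1 b hb).1.symm⟩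
    have := arr_mul_pathEl (k := k) (rel := rel) a (Q.tgt a, l)
    rw [if_pos rfl] at this
    rw [← this, coeff_mul, ih _ hl, leftAction_arr, arrOp_single, if_pos ⟨rfl, h.1⟩]

theorem coeff_ofCoeff (m : Q.V × List Q.Arr →₀ k) (p : Q.V × List Q.Arr) :
    coeff k rel (ofCoeff k rel m) p = if ValidPath rel p then m p else 0 := by
  induction m using Finsupp.induction_linear with
  | zero => simp
  | add f g hf hg =>
    rw [map_add, map_add, Finsupp.add_apply, hf, hg]
    split_ifs <;> simp
  | single q r =>
    rw [ofCoeff_single, map_smul, coeff_pathEl, Finsupp.smul_apply]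
    by_cases hqp : q = p
    · subst hqp
      split_ifs <;> simp
    · split_ifs <;> simp [hqp]

theorem validPath_of_coeff_ne_zero {x : GA k Q rel} {p : Q.V × List Q.Arr}
    (h : coeff k rel x p ≠ 0) : ValidPath rel p := by
  rw [← ofCoeff_coeff x, coeff_ofCoeff] at h
  by_contra hp
  exact h (if_neg hp)

theorem coeff_vtx_mul (x : GA k Q rel) (u v : Q.V) (l : List Q.Arr) :
    coeff k rel (vtx k Q rel u * x) (v, l) = if v = u then coeff k rel x (v, l) else 0 := by
  rw [coeff_mul, leftAction_vtx]
  induction coeff k rel x using Finsupp.induction_linear with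
  | zero => simp
  | add f g hf hg =>
    rw [map_add, Finsupp.add_apply, hf, hg, Finsupp.add_apply]
    split_ifs <;> simp
  | single q r =>
    rw [vtxOp_single]
    by_cases hq : q = (v, l)
    · subst hq
      split_ifs <;> simp
    · split_ifs <;> simp [hq]

theorem coeff_arr_mul_cons (x : GA k Q rel) {a : Q.Arr} {l : List Q.Arr}
    (h : AllowedWord rel (a :: l)) (b : Q.Arr) :
    coeff k rel (arr k Q rel b * x) (Q.src a, a :: l) =
      if a = b then coeff k rel x (Q.tgt a, l) else 0 := by
  rw [coeff_mul, leftAction_arr]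
  induction coeff k rel x using Finsupp.induction_linear with
  | zero => simp
  | add f g hf hg =>
    rw [map_add, Finsupp.add_apply, hf, hg, Finsupp.add_apply]
    split_ifs <;> simp
  | single q r =>
    obtain ⟨w, l'⟩ := q
    rw [arrOp_single]
    by_cases hab : a = b
    · subst hab
      by_cases hl : l' = l
      · subst hl
        by_cases hw : w = Q.tgt a
        · simp [hw, h]
        · simp [hw]
      · split_ifs <;> simp [hl]
    · rw [if_neg hab]
      split_ifs <;> simp [Ne.symm hab]

theorem coeff_mul_arr_append (x : GA k Q rel) {v : Q.V} {a : Q.Arr} {l : List Q.Arr}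
    (h : ValidPath rel (v, l ++ [a])) (b : Q.Arr) :
    coeff k rel (x * arr k Q rel b) (v, l ++ [a]) =
      if a = b then coeff k rel x (v, l) else 0 := by
  conv_lhs => rw [← ofCoeff_coeff x]
  induction coeff k rel x using Finsupp.induction_linear with
  | zero => simp
  | add f g hf hg =>
    rw [map_add, add_mul, map_add, Finsupp.add_apply, hf, hg, Finsupp.add_apply]
    split_ifs <;> simp
  | single q r =>
    rw [ofCoeff_single, smul_mul_assoc, pathEl_mul_arr, ← ofCoeff_single, coeff_ofCoeff, if_pos h]
    obtain ⟨w, l'⟩ := q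
    by_cases hab : a = b
    · simp [Finsupp.single_apply, hab]
    · simp [hab]

theorem coeff_mul_vtx (x : GA k Q rel) {v : Q.V} {a : Q.Arr} {l : List Q.Arr}
    (ha : a ∈ l.getLast?) (u : Q.V) :
    coeff k rel (x * vtx k Q rel u) (v, l) =
      if Q.tgt a = u then coeff k rel x (v, l) else 0 := by
  have key : ∀ m : Q.V × List Q.Arr →₀ k,
      coeff k rel (ofCoeff k rel m * vtx k Q rel u) (v, l) =
        if Q.tgt a = u then coeff k rel (ofCoeff k rel m) (v, l) else 0 := by
    intro m
    induction m using Finsupp.induction_linear with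
    | zero => simp
    | add f g hf hg =>
      rw [map_add, add_mul, map_add, Finsupp.add_apply, hf, hg, map_add, Finsupp.add_apply]
      split_ifs <;> simp
    | single q r =>
      obtain ⟨w, l'⟩ := q
      rw [ofCoeff_single, smul_mul_assoc, map_smul, map_smul, Finsupp.smul_apply,
        Finsupp.smul_apply, coeff_pathEl]
      rcases hb : l'.getLast? with _ | b
      · obtain rfl : l' = [] := by simpa using hb
        have hl : l ≠ [] := by rintro rfl; simp at ha
        by_cases hwu : w = u
        · subst hwu
          have : pathEl k rel (w, []) * vtx k Q rel w = pathEl k rel (w, []) := by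
            simp [pathEl, vtx_mul_self]
          rw [this, coeff_pathEl]
          split_ifs <;> simp [hl.symm]
        · have : pathEl k rel (w, []) * vtx k Q rel u = 0 := by
            simp [pathEl, vtx_mul_of_ne hwu]
          rw [this]
          split_ifs <;> simp [hl.symm]
      · have : pathEl k rel (w, l') * vtx k Q rel u =
            if Q.tgt b = u then pathEl k rel (w, l') else 0 := by
          rw [pathEl, mul_assoc, wordEl_mul_vtx hb]
          split_ifs <;> simp
        rw [this]
        by_cases hl : l' = l
        · subst hl
          obtain rfl : a = b := by
            rw [Option.mem_def, hb] at ha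
            exact (Option.some.inj ha).symm
          by_cases hu : Q.tgt a = u <;> simp [hu, coeff_pathEl]
        · by_cases hu : Q.tgt b = u <;> by_cases hv : ValidPath rel (w, l') <;>
            simp [hu, hv, coeff_pathEl, hl]
  simpa only [ofCoeff_coeff] using key (coeff k rel x)

end PathBasis

section Cycles

open Function

variable {Q : Quiv} (rel : Q.Arr → Q.Arr → Prop)

/-- The arrow continuing `a` to an allowed path, if there is one, and `a` itself otherwise. -/
def step (a : Q.Arr) : Q.Arr :=
  open Classical in if h : ∃ b, dualRel rel a b then h.choose else a

/-- The arrow `a` lies on an infinite maximal path. -/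
def OnCycle (a : Q.Arr) : Prop :=
  a ∈ periodicPts (step rel) ∧ ∀ i, dualRel rel ((step rel)^[i] a) ((step rel)^[i + 1] a)

/-- The primitive cycle starting at `a`. -/
def cyc (a : Q.Arr) : List Q.Arr := List.iterate (step rel) a (minimalPeriod (step rel) a)

variable {rel}

theorem dualRel_left_unique (hg : IsGentleRel Q rel) {a b c : Q.Arr} (ha : dualRel rel a c)
    (hb : dualRel rel b c) : a = b := by
  by_contra h
  rcases hg.cond_ii c a b h ha.1 hb.1 with h | h
  · exact ha.2 h.1
  · exact hb.2 h.1

theorem dualRel_right_unique (hg : IsGentleRel Q rel) {a b c : Q.Arr} (hb : dualRel rel a b)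
    (hc : dualRel rel a c) : b = c := by
  by_contra h
  rcases hg.cond_iii a b c h hb.1 hc.1 with h | h
  · exact hb.2 h.1
  · exact hc.2 h.1

theorem step_eq (hg : IsGentleRel Q rel) {a b : Q.Arr} (h : dualRel rel a b) : step rel a = b := by
  have he : ∃ b, dualRel rel a b := ⟨b, h⟩
  rw [step, dif_pos he]
  exact dualRel_right_unique hg he.choose_spec h

theorem eq_iterate_of_allowedWord (hg : IsGentleRel Q rel) {a : Q.Arr} {l : List Q.Arr}
    (h : AllowedWord rel (a :: l)) : a :: l = List.iterate (step rel) a (l.length + 1) := by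
  induction l generalizing a with
  | nil => rfl
  | cons b l ih =>
    rw [allowedWord_cons] at h
    rw [List.length_cons, List.iterate, step_eq hg (h.1 b rfl), ← ih h.2]

theorem eq_iterate_of_head? (hg : IsGentleRel Q rel) {a : Q.Arr} {l : List Q.Arr}
    (h : AllowedWord rel l) (ha : a ∈ l.head?) : l = List.iterate (step rel) a l.length := by
  cases l with
  | nil => simp at ha
  | cons b l =>
    obtain rfl : b = a := by simpa using ha
    exact eq_iterate_of_allowedWord hg h

theorem head?_iterate {α : Type*} (f : α → α) (a : α) {n : ℕ} (hn : 0 < n) :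
    (List.iterate f a n).head? = some a := by
  obtain ⟨n, rfl⟩ := Nat.exists_eq_succ_of_ne_zero hn.ne'
  rfl

theorem iterate_succ_eq_append {α : Type*} (f : α → α) (a : α) (n : ℕ) :
    List.iterate f a (n + 1) = List.iterate f a n ++ [f^[n] a] :=
  List.iterate_add f a n 1

theorem getLast?_iterate {α : Type*} (f : α → α) (a : α) (n : ℕ) :
    (List.iterate f a (n + 1)).getLast? = some (f^[n] a) := by
  rw [iterate_succ_eq_append, List.getLast?_append]
  rfl

namespace OnCycle

variable {a b : Q.Arr}

theorem iterate (h : OnCycle rel a) (i : ℕ) : OnCycle rel ((step rel)^[i] a) := by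
  refine ⟨?_, fun j => ?_⟩
  · obtain ⟨n, hn, hp⟩ := h.1
    exact ⟨n, hn, hp.apply_iterate i⟩
  · simpa only [← iterate_add_apply, add_right_comm] using h.2 (j + i)

theorem minimalPeriod_pos (h : OnCycle rel a) : 0 < minimalPeriod (step rel) a :=
  minimalPeriod_pos_of_mem_periodicPts h.1

theorem minimalPeriod_iterate (h : OnCycle rel a) (i : ℕ) :
    minimalPeriod (step rel) ((step rel)^[i] a) = minimalPeriod (step rel) a :=
  minimalPeriod_apply_iterate h.1 i

theorem allowedWord_iterate (h : OnCycle rel a) (n : ℕ) :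
    AllowedWord rel (List.iterate (step rel) a n) := by
  induction n generalizing a with
  | zero => exact List.isChain_nil
  | succ n ih =>
    refine allowedWord_cons.2 ⟨fun b hb => ?_, ih (h.iterate 1)⟩
    rcases n.eq_zero_or_pos with rfl | hn
    · simp [List.iterate] at hb
    · rw [head?_iterate _ _ hn] at hb
      obtain rfl : step rel a = b := by simpa using hb
      exact h.2 0

theorem dualRel_pred (h : OnCycle rel a) {n : ℕ} (hn : (step rel)^[n + 1] a = a) :
    dualRel rel ((step rel)^[n] a) a := by
  have := h.2 n
  rwa [hn] at this

theorem mem_cyc_iff (h : OnCycle rel a) : b ∈ cyc rel a ↔ ∃ m, b = (step rel)^[m] a := by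
  rw [cyc, List.mem_iterate]
  refine ⟨fun ⟨m, _, hm⟩ => ⟨m, hm⟩, fun ⟨m, hm⟩ => ⟨_, Nat.mod_lt m h.minimalPeriod_pos, ?_⟩⟩
  rw [iterate_mod_minimalPeriod_eq, hm]

theorem of_mem_cyc (h : OnCycle rel a) (hb : b ∈ cyc rel a) : OnCycle rel b := by
  obtain ⟨m, rfl⟩ := h.mem_cyc_iff.1 hb
  exact h.iterate m

theorem self_mem_cyc (h : OnCycle rel a) : a ∈ cyc rel a :=
  h.mem_cyc_iff.2 ⟨0, rfl⟩

theorem mem_cyc_symm (h : OnCycle rel a) (hb : b ∈ cyc rel a) : a ∈ cyc rel b := by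
  obtain ⟨m, hm, rfl⟩ := List.mem_iterate.1 hb
  refine (h.iterate m).mem_cyc_iff.2 ⟨minimalPeriod (step rel) a - m, ?_⟩
  rw [← iterate_add_apply, Nat.sub_add_cancel hm.le, iterate_minimalPeriod]

theorem mem_cyc_congr (h : OnCycle rel a) (hb : b ∈ cyc rel a) {c : Q.Arr} :
    c ∈ cyc rel b ↔ c ∈ cyc rel a := by
  have key : ∀ {a b : Q.Arr}, OnCycle rel a → b ∈ cyc rel a → c ∈ cyc rel b → c ∈ cyc rel a := by
    intro a b h hb hc
    obtain ⟨i, rfl⟩ := (h.of_mem_cyc hb).mem_cyc_iff.1 hc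
    obtain ⟨m, rfl⟩ := h.mem_cyc_iff.1 hb
    exact h.mem_cyc_iff.2 ⟨i + m, (iterate_add_apply _ _ _ _).symm⟩
  exact ⟨key h hb, key (h.of_mem_cyc hb) (h.mem_cyc_symm hb)⟩

theorem step_mem_cyc (h : OnCycle rel a) (hb : b ∈ cyc rel a) : step rel b ∈ cyc rel a := by
  obtain ⟨m, rfl⟩ := h.mem_cyc_iff.1 hb
  exact h.mem_cyc_iff.2 ⟨m + 1, (iterate_succ_apply' _ _ _).symm⟩

theorem nodup_cyc (a : Q.Arr) : (cyc rel a).Nodup := by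
  rw [cyc, ← List.range_map_iterate]
  refine List.Nodup.map_on (fun i hi j hj hij => ?_) List.nodup_range
  exact iterate_injOn_Iio_minimalPeriod (by simpa using hi) (by simpa using hj) hij

theorem iterate_minimalPeriod_mul (a : Q.Arr) (j : ℕ) :
    (step rel)^[minimalPeriod (step rel) a * j] a = a :=
  (isPeriodicPt_minimalPeriod _ _).mul_const j

theorem rotTo_cyc (h : OnCycle rel a) (hb : b ∈ cyc rel a) : rotTo (cyc rel a) b = cyc rel b := by
  obtain ⟨m, hm, rfl⟩ := List.mem_iterate.1 hb
  have hsplit : cyc rel a = List.iterate (step rel) a m ++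
      List.iterate (step rel) ((step rel)^[m] a) (minimalPeriod (step rel) a - m) := by
    rw [← List.iterate_add, Nat.add_sub_cancel' hm.le, cyc]
  have hnot : ∀ x ∈ List.iterate (step rel) a m, (x != (step rel)^[m] a) = true := by
    intro x hx
    obtain ⟨i, hi, rfl⟩ := List.mem_iterate.1 hx
    simp only [bne_iff_ne, ne_eq]
    intro he
    exact hi.ne (iterate_injOn_Iio_minimalPeriod (hi.trans hm) hm he)
  obtain ⟨r, hr⟩ := Nat.exists_eq_succ_of_ne_zero (Nat.sub_pos_of_lt hm).ne'
  rw [rotTo, hsplit, List.dropWhile_append_of_pos hnot, List.takeWhile_append_of_pos hnot, cyc,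
    h.minimalPeriod_iterate]
  conv_rhs => rw [← Nat.sub_add_cancel hm.le, List.iterate_add, ← iterate_add_apply,
    Nat.sub_add_cancel hm.le, iterate_minimalPeriod]
  rw [hr, List.iterate]
  simp

theorem flatten_replicate_cyc (a : Q.Arr) (j : ℕ) :
    (List.replicate j (cyc rel a)).flatten =
      List.iterate (step rel) a (minimalPeriod (step rel) a * j) := by
  induction j with
  | zero => rfl
  | succ j ih =>
    rw [List.replicate_succ, List.flatten_cons, ih, Nat.mul_succ, add_comm, List.iterate_add,
      iterate_minimalPeriod, cyc]

theorem primCycleSq_cyc (h : OnCycle rel a) : PrimCycleSq rel (cyc rel a) := by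
  have hpos := h.minimalPeriod_pos
  refine ⟨fun hn => hpos.ne' (List.iterate_eq_nil.1 hn), ?_, ?_, fun l n hn he => ?_⟩
  · have := h.allowedWord_iterate (minimalPeriod (step rel) a + minimalPeriod (step rel) a)
    rwa [List.iterate_add, iterate_minimalPeriod] at this
  · obtain ⟨n, hn⟩ := Nat.exists_eq_succ_of_ne_zero hpos.ne'
    have hd := h.dualRel_pred (n := n) (by rw [← Nat.succ_eq_add_one, ← hn, iterate_minimalPeriod])
    rw [wTgt?, wSrc?, cyc, head?_iterate _ _ hpos, hn, getLast?_iterate]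
    simp [hd.1]
  · obtain ⟨n, rfl⟩ := Nat.exists_eq_add_of_le' hn
    rw [List.replicate_succ, List.replicate_succ, List.flatten_cons, List.flatten_cons] at he
    have hlen := congrArg List.length he
    rw [cyc, List.length_iterate, List.length_append, List.length_append] at hlen
    have hl : 0 < l.length := by
      rw [List.length_pos_iff]
      rintro rfl
      simp at hlen
      exact hpos.ne' hlen
    have h0 := congrArg (fun w => w[0]?) he
    have h1 := congrArg (fun w => w[l.length]?) he
    simp only [cyc] at h0 h1
    rw [List.getElem?_iterate _ _ _ _ (by omega), List.getElem?_append_left hl] at h0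
    rw [List.getElem?_iterate _ _ _ _ (by omega), List.getElem?_append_right le_rfl, Nat.sub_self,
      List.getElem?_append_left hl, ← h0] at h1
    exact not_isPeriodicPt_of_pos_of_lt_minimalPeriod hl.ne' (by omega)
      (Option.some.inj h1)

end OnCycle

theorem onCycle_of_allowedWord_append_self (hg : IsGentleRel Q rel) {a : Q.Arr} {l : List Q.Arr}
    (h : AllowedWord rel (l ++ l)) (ha : a ∈ l.head?) :
    OnCycle rel a ∧ ∃ j, 1 ≤ j ∧
      l = List.iterate (step rel) a (minimalPeriod (step rel) a * j) := by
  have hl := eq_iterate_of_head? hg (allowedWord_append.1 h).1 ha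
  have hpos : 0 < l.length := by
    rw [List.length_pos_iff]
    rintro rfl
    simp at ha
  have hll := eq_iterate_of_head? hg h (a := a) (by
    rw [List.head?_append, Option.mem_def.1 ha]; rfl)
  rw [List.length_append] at hll
  have hper : IsPeriodicPt (step rel) l.length a := by
    have h2 := hll
    rw [List.iterate_add, ← hl] at h2
    have h3 := List.append_cancel_left h2
    have h4 := congrArg List.head? h3
    rw [head?_iterate _ _ hpos, Option.mem_def.1 ha] at h4
    exact (Option.some.inj h4).symm
  have hlt : ∀ i < l.length, dualRel rel ((step rel)^[i] a) ((step rel)^[i + 1] a) := by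
    intro i hi
    have hc : (l ++ l).IsChain (dualRel rel) := h
    rw [hll, List.isChain_iff_getElem] at hc
    have := hc i (by rw [List.length_iterate]; omega)
    rwa [List.getElem_iterate, List.getElem_iterate] at this
  refine ⟨⟨⟨_, hpos, hper⟩, fun i => ?_⟩, ?_⟩
  · have := hlt _ (Nat.mod_lt i hpos)
    rwa [iterate_succ_apply', hper.iterate_mod_apply, ← iterate_succ_apply' (step rel)] at this
  · obtain ⟨j, hj⟩ := hper.minimalPeriod_dvd
    refine ⟨j, ?_, by rw [← hj, ← hl]⟩
    by_contra hj0
    obtain rfl : j = 0 := by omega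
    omega

theorem primCycleSq_iff (hg : IsGentleRel Q rel) {c : List Q.Arr} :
    PrimCycleSq rel c ↔ ∃ a, OnCycle rel a ∧ c = cyc rel a := by
  constructor
  · rintro ⟨hne, hc, -, hp⟩
    obtain ⟨a, ha⟩ := Option.ne_none_iff_exists'.1 (mt List.head?_eq_none_iff.1 hne)
    obtain ⟨h, j, hj, he⟩ := onCycle_of_allowedWord_append_self hg hc ha
    refine ⟨a, h, ?_⟩
    rw [← OnCycle.flatten_replicate_cyc] at he
    obtain rfl | hj : j = 1 ∨ 2 ≤ j := by omega
    · simpa using he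
    · exact absurd he (hp _ _ hj)
  · rintro ⟨a, h, rfl⟩
    exact h.primCycleSq_cyc

end Cycles

section Blocks

open Function

variable {k : Type} [Field k] {Q : Quiv} {rel : Q.Arr → Q.Arr → Prop}

theorem pathEl_src {a : Q.Arr} {l : List Q.Arr} (ha : a ∈ l.head?) :
    pathEl k rel (Q.src a, l) = wordEl k Q rel l := by
  rw [pathEl, vtx_mul_wordEl ha, if_pos rfl]

theorem mEl_cyc {a : Q.Arr} (h : OnCycle rel a) :
    mEl k Q rel (cyc rel a) = ∑ b ∈ (cyc rel a).toFinset, wordEl k Q rel (cyc rel b) := by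
  rw [List.sum_toFinset _ (OnCycle.nodup_cyc a), mEl]
  congr 1
  exact List.map_congr_left fun b hb => by rw [h.rotTo_cyc hb]

theorem wordEl_iterate_mul_wordEl_of_ne (hg : IsGentleRel Q rel) {a b : Q.Arr}
    (h : OnCycle rel a) {n : ℕ} (hn : 0 < n) (hp : (step rel)^[n] a = a) (hab : a ≠ b)
    {l : List Q.Arr} (hb : b ∈ l.head?) :
    wordEl k Q rel (List.iterate (step rel) a n) * wordEl k Q rel l = 0 := by
  rw [← wordEl_append]
  refine wordEl_of_not_allowedWord fun hw => hab ?_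
  obtain ⟨n, rfl⟩ := Nat.exists_eq_succ_of_ne_zero hn.ne'
  have hd := (allowedWord_append.1 hw).2.2 _ (getLast?_iterate _ _ _) b hb
  exact dualRel_right_unique hg (h.dualRel_pred hp) hd

theorem mEl_cyc_pow (hg : IsGentleRel Q rel) {a : Q.Arr} (h : OnCycle rel a) {j : ℕ}
    (hj : 1 ≤ j) :
    mEl k Q rel (cyc rel a) ^ j = ∑ b ∈ (cyc rel a).toFinset,
      wordEl k Q rel (List.iterate (step rel) b (minimalPeriod (step rel) b * j)) := by
  induction j, hj using Nat.le_induction with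
  | base => rw [pow_one, mEl_cyc h]; simp only [mul_one, cyc]
  | succ j hj ih =>
    rw [pow_succ, ih, mEl_cyc h, Finset.sum_mul_sum]
    refine Finset.sum_congr rfl fun b hb => ?_
    have hbc := h.of_mem_cyc (List.mem_toFinset.1 hb)
    rw [Finset.sum_eq_single_of_mem b hb]
    · rw [Nat.mul_succ, List.iterate_add, OnCycle.iterate_minimalPeriod_mul, wordEl_append, cyc]
    · intro c hc hcb
      have hcc := h.of_mem_cyc (List.mem_toFinset.1 hc)
      exact wordEl_iterate_mul_wordEl_of_ne hg hbc (Nat.mul_pos hbc.minimalPeriod_pos hj)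
        (OnCycle.iterate_minimalPeriod_mul b j) hcb.symm
        (head?_iterate _ _ hcc.minimalPeriod_pos)

theorem mEl_cyc_mem_center (hg : IsGentleRel Q rel) {a : Q.Arr} (h : OnCycle rel a) :
    mEl k Q rel (cyc rel a) ∈ Subalgebra.center k (GA k Q rel) := by
  have hlast : ∀ {b}, OnCycle rel b → ∃ c, dualRel rel c b ∧ c ∈ (cyc rel b).getLast? ∧
      c ∈ cyc rel b := by
    intro b hb
    obtain ⟨n, hn⟩ := Nat.exists_eq_succ_of_ne_zero hb.minimalPeriod_pos.ne'
    refine ⟨(step rel)^[n] b, hb.dualRel_pred ?_, ?_, hb.mem_cyc_iff.2 ⟨n, rfl⟩⟩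
    · rw [← Nat.succ_eq_add_one, ← hn, iterate_minimalPeriod]
    · rw [cyc, hn]
      exact getLast?_iterate _ _ _
  have hhead : ∀ {b}, OnCycle rel b → b ∈ (cyc rel b).head? := fun hb =>
    head?_iterate _ _ hb.minimalPeriod_pos
  rw [mEl_cyc h, mem_center_iff_commute_generators]
  refine ⟨fun v => ?_, fun x => ?_⟩
  · rw [Finset.mul_sum, Finset.sum_mul]
    refine Finset.sum_congr rfl fun b hb => ?_
    have hbc := h.of_mem_cyc (List.mem_toFinset.1 hb)
    obtain ⟨c, hcb, hc, -⟩ := hlast hbc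
    rw [vtx_mul_wordEl (hhead hbc), wordEl_mul_vtx hc, hcb.1]
  · rw [Finset.mul_sum, Finset.sum_mul]
    have hleft : ∀ b ∈ (cyc rel a).toFinset, x ∈ (cyc rel a).toFinset → b ≠ step rel x →
        arr k Q rel x * wordEl k Q rel (cyc rel b) = 0 := by
      intro b hb _ hne
      rw [← wordEl_cons]
      refine wordEl_of_not_allowedWord fun hw => hne ?_
      exact (step_eq hg ((allowedWord_cons.1 hw).1 b
        (hhead (h.of_mem_cyc (List.mem_toFinset.1 hb))))).symm
    have hright : ∀ b ∈ (cyc rel a).toFinset, b ≠ x →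
        wordEl k Q rel (cyc rel b) * arr k Q rel x = 0 := by
      intro b hb hne
      have hbc := h.of_mem_cyc (List.mem_toFinset.1 hb)
      simpa [cyc] using wordEl_iterate_mul_wordEl_of_ne (k := k) hg hbc hbc.minimalPeriod_pos
        iterate_minimalPeriod hne (l := [x]) rfl
    by_cases hx : x ∈ (cyc rel a).toFinset
    · have hx' := List.mem_toFinset.1 hx
      rw [Finset.sum_eq_single_of_mem (step rel x)
        (List.mem_toFinset.2 (h.step_mem_cyc hx')) (fun b hb => hleft b hb hx),
        Finset.sum_eq_single_of_mem x hx hright, ← wordEl_cons]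
      have hxc := h.of_mem_cyc hx'
      have e1 : x :: cyc rel (step rel x) =
          List.iterate (step rel) x (minimalPeriod (step rel) x + 1) := by
        rw [List.iterate, cyc, ← hxc.minimalPeriod_iterate 1, iterate_one]
      rw [e1, iterate_succ_eq_append, iterate_minimalPeriod]
      simp [cyc]
    · rw [Finset.sum_eq_zero, Finset.sum_eq_zero]
      · exact fun b hb => hright b hb fun hbx => hx (hbx ▸ hb)
      · intro b hb
        have hb' := List.mem_toFinset.1 hb
        have hbc := h.of_mem_cyc hb'
        rw [← wordEl_cons]
        refine wordEl_of_not_allowedWord fun hw => hx ?_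
        obtain ⟨c, hcb, -, hc⟩ := hlast hbc
        rw [dualRel_left_unique hg ((allowedWord_cons.1 hw).1 b (hhead hbc)) hcb]
        exact List.mem_toFinset.2 ((h.mem_cyc_congr hb').1 hc)

variable (rel) in
/-- The supports of the proposed basis elements of the center. -/
inductive IsBlock : Finset (Q.V × List Q.Arr) → Prop
  | one : IsBlock (Finset.univ.image fun v => (v, []))
  | finite {a : Q.Arr} {l : List Q.Arr} : FiniteMaxWord rel l → wTgt? l = wSrc? l →
      a ∈ l.head? → IsBlock {(Q.src a, l)}
  | infinite {a : Q.Arr} {j : ℕ} : OnCycle rel a → 1 ≤ j →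
      IsBlock ((cyc rel a).toFinset.image fun b =>
        (Q.src b, List.iterate (step rel) b (minimalPeriod (step rel) b * j)))

variable (k rel) in
/-- The sum of the paths in a finite set. -/
def blockEl (S : Finset (Q.V × List Q.Arr)) : GA k Q rel := ∑ p ∈ S, pathEl k rel p

theorem blockEl_one : blockEl k rel (Finset.univ.image fun v : Q.V => (v, [])) = 1 := by
  rw [blockEl, Finset.sum_image (by simp [Set.InjOn])]
  simp [pathEl, sum_vtx]

theorem blockEl_finite {a : Q.Arr} {l : List Q.Arr} (ha : a ∈ l.head?) :
    blockEl k rel {(Q.src a, l)} = wordEl k Q rel l := by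
  rw [blockEl, Finset.sum_singleton, pathEl_src ha]

theorem head_mem_of_iterate_mul {a b : Q.Arr} (h : OnCycle rel a) (hb : b ∈ cyc rel a) {j : ℕ}
    (hj : 1 ≤ j) :
    b ∈ (List.iterate (step rel) b (minimalPeriod (step rel) b * j)).head? :=
  head?_iterate _ _ (Nat.mul_pos (h.of_mem_cyc hb).minimalPeriod_pos hj)

theorem blockEl_infinite (hg : IsGentleRel Q rel) {a : Q.Arr} {j : ℕ} (h : OnCycle rel a)
    (hj : 1 ≤ j) :
    blockEl k rel ((cyc rel a).toFinset.image fun b =>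
        (Q.src b, List.iterate (step rel) b (minimalPeriod (step rel) b * j))) =
      mEl k Q rel (cyc rel a) ^ j := by
  rw [mEl_cyc_pow hg h hj, blockEl, Finset.sum_image]
  · refine Finset.sum_congr rfl fun b hb => pathEl_src ?_
    exact head_mem_of_iterate_mul h (List.mem_toFinset.1 hb) hj
  · intro b hb c hc hbc
    have h1 := head_mem_of_iterate_mul h (List.mem_toFinset.1 hb) hj
    have h2 := head_mem_of_iterate_mul h (List.mem_toFinset.1 hc) hj
    have hw := (Prod.ext_iff.1 hbc).2
    simp only at hw
    rw [hw] at h1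
    exact Option.mem_unique h1 h2

theorem setOf_blockEl_eq (hg : IsGentleRel Q rel) :
    {x | ∃ S, IsBlock rel S ∧ x = blockEl k rel S} =
      ({1} : Set (GA k Q rel)) ∪
       {x | ∃ l : List Q.Arr, FiniteMaxWord rel l ∧ wTgt? l = wSrc? l ∧
          x = wordEl k Q rel l} ∪
       {x | ∃ (c : List Q.Arr) (j : ℕ), PrimCycleSq rel c ∧ 1 ≤ j ∧
          x = (mEl k Q rel c) ^ j} := by
  ext x
  constructor
  · rintro ⟨S, hS, rfl⟩
    cases hS with
    | one => exact Or.inl (Or.inl blockEl_one)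
    | finite hl hc ha => exact Or.inl (Or.inr ⟨_, hl, hc, blockEl_finite ha⟩)
    | infinite h hj => exact Or.inr ⟨_, _, h.primCycleSq_cyc, hj, blockEl_infinite hg h hj⟩
  · rintro ((rfl | ⟨l, hl, hc, rfl⟩) | ⟨c, j, hc, hj, rfl⟩)
    · exact ⟨_, .one, blockEl_one.symm⟩
    · obtain ⟨a, ha⟩ := Option.ne_none_iff_exists'.1 (mt List.head?_eq_none_iff.1 hl.1.1)
      exact ⟨_, .finite hl hc ha, (blockEl_finite ha).symm⟩
    · obtain ⟨a, ha, rfl⟩ := (primCycleSq_iff hg).1 hc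
      exact ⟨_, .infinite ha hj, (blockEl_infinite hg ha hj).symm⟩

theorem wTgt?_eq_wSrc?_iff {l : List Q.Arr} {a b : Q.Arr} (ha : a ∈ l.head?)
    (hb : b ∈ l.getLast?) : wTgt? l = wSrc? l ↔ Q.tgt b = Q.src a := by
  rw [wTgt?, wSrc?, Option.mem_def.1 ha, Option.mem_def.1 hb]
  simp

theorem exists_mem_getLast? {l : List Q.Arr} {a : Q.Arr} (ha : a ∈ l.head?) :
    ∃ b, b ∈ l.getLast? :=
  Option.ne_none_iff_exists'.1 (mt List.getLast?_eq_none_iff.1 (by rintro rfl; simp at ha))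

namespace IsBlock

variable {S S' : Finset (Q.V × List Q.Arr)}

theorem nonempty (hS : IsBlock rel S) : S.Nonempty := by
  cases hS with
  | one => exact Finset.univ_nonempty.image _
  | finite => exact Finset.singleton_nonempty _
  | infinite h => exact ⟨_, Finset.mem_image_of_mem _ (List.mem_toFinset.2 h.self_mem_cyc)⟩

theorem validPath (hS : IsBlock rel S) {p : Q.V × List Q.Arr} (hp : p ∈ S) :
    ValidPath rel p := by
  cases hS with
  | one =>
    obtain ⟨v, -, rfl⟩ := Finset.mem_image.1 hp
    exact ⟨List.isChain_nil, by simp⟩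
  | finite hl hc ha =>
    obtain rfl := Finset.mem_singleton.1 hp
    exact ⟨hl.1.2.1, fun b hb => by rw [Option.mem_unique hb ha]⟩
  | infinite h hj =>
    obtain ⟨b, hb, rfl⟩ := Finset.mem_image.1 hp
    rw [List.mem_toFinset] at hb
    refine ⟨(h.of_mem_cyc hb).allowedWord_iterate _, fun c hc => ?_⟩
    rw [Option.mem_unique hc (head_mem_of_iterate_mul h hb hj)]

theorem eq_of_mem (hS : IsBlock rel S) (hS' : IsBlock rel S') {p : Q.V × List Q.Arr}
    (hp : p ∈ S) (hp' : p ∈ S') : S = S' := by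
  have hone : ∀ {p : Q.V × List Q.Arr},
      p ∈ Finset.univ.image (fun v : Q.V => (v, ([] : List Q.Arr))) → p.2 = [] := by
    intro p hp
    obtain ⟨v, -, rfl⟩ := Finset.mem_image.1 hp
    rfl
  have hinf : ∀ {a : Q.Arr} {j : ℕ} {l : List Q.Arr}, OnCycle rel a → FiniteMaxWord rel l →
      l ≠ List.iterate (step rel) a j := by
    rintro a j l h hl rfl
    apply hl.1.2.2 ((step rel)^[j] a)
    rw [← iterate_succ_eq_append]
    exact h.allowedWord_iterate _
  cases hS with
  | one =>
    cases hS' with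
    | one => rfl
    | finite hl hc ha =>
      obtain rfl := Finset.mem_singleton.1 hp'
      exact absurd (hone hp) hl.1.1
    | infinite h hj =>
      obtain ⟨b, hb, rfl⟩ := Finset.mem_image.1 hp'
      have := head_mem_of_iterate_mul h (List.mem_toFinset.1 hb) hj
      rw [show List.iterate _ _ _ = [] from hone hp] at this
      simp at this
  | finite hl hc ha =>
    obtain rfl := Finset.mem_singleton.1 hp
    cases hS' with
    | one => exact absurd (hone hp') hl.1.1
    | finite hl' hc' ha' => rw [Finset.mem_singleton.1 hp']
    | infinite h hj =>
      obtain ⟨b, hb, he⟩ := Finset.mem_image.1 hp'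
      exact absurd (Prod.ext_iff.1 he).2.symm (hinf (h.of_mem_cyc (List.mem_toFinset.1 hb)) hl)
  | @infinite a j h hj =>
    obtain ⟨b, hb, rfl⟩ := Finset.mem_image.1 hp
    rw [List.mem_toFinset] at hb
    cases hS' with
    | one =>
      have := head_mem_of_iterate_mul h hb hj
      rw [show List.iterate _ _ _ = [] from hone hp'] at this
      simp at this
    | finite hl hc ha =>
      have he := Finset.mem_singleton.1 hp'
      exact absurd (Prod.ext_iff.1 he).2.symm (hinf (h.of_mem_cyc hb) hl)
    | @infinite a' j' h' hj' =>
      obtain ⟨b', hb', he⟩ := Finset.mem_image.1 hp'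
      rw [List.mem_toFinset] at hb'
      have hw := (Prod.ext_iff.1 he).2
      simp only at hw
      have hhead := head_mem_of_iterate_mul h hb hj
      rw [← hw] at hhead
      obtain rfl := Option.mem_unique hhead (head_mem_of_iterate_mul h' hb' hj')
      have hlen := congrArg List.length hw
      rw [List.length_iterate, List.length_iterate] at hlen
      obtain rfl := Nat.eq_of_mul_eq_mul_left (h.of_mem_cyc hb).minimalPeriod_pos hlen
      have : (cyc rel a).toFinset = (cyc rel a').toFinset := by
        ext c
        rw [List.mem_toFinset, List.mem_toFinset, ← h.mem_cyc_congr hb, h'.mem_cyc_congr hb']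
      rw [this]

theorem blockEl_mem_center (hg : IsGentleRel Q rel) (hS : IsBlock rel S) :
    blockEl k rel S ∈ Subalgebra.center k (GA k Q rel) := by
  cases hS with
  | one => rw [blockEl_one]; exact one_mem _
  | @finite a l hl hc ha =>
    rw [blockEl_finite ha, mem_center_iff_commute_generators]
    obtain ⟨b, hb⟩ := exists_mem_getLast? ha
    refine ⟨fun v => ?_, fun x => ?_⟩
    · rw [vtx_mul_wordEl ha, wordEl_mul_vtx hb, (wTgt?_eq_wSrc?_iff ha hb).1 hc]
    · rw [← wordEl_cons, wordEl_of_not_allowedWord (hl.2.2.2 x)]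
      have := wordEl_of_not_allowedWord (k := k) (hl.1.2.2 x)
      simpa using this.symm
  | infinite h hj =>
    rw [blockEl_infinite hg h hj]
    exact pow_mem (mEl_cyc_mem_center hg h) _

theorem coeff_blockEl (hS : IsBlock rel S) (p : Q.V × List Q.Arr) :
    coeff k rel (blockEl k rel S) p = if p ∈ S then 1 else 0 := by
  rw [blockEl, map_sum, Finset.sum_congr rfl
    fun q hq => by rw [coeff_pathEl, if_pos (hS.validPath hq)], Finsupp.finsetSum_apply]
  simp [Finsupp.single_apply]

end IsBlock

theorem linearIndependent_blockEl :
    LinearIndependent k (fun x : {x | ∃ S, IsBlock rel S ∧ x = blockEl k rel S} =>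
      (x : GA k Q rel)) := by
  rw [linearIndependent_iff']
  rintro s g hsum ⟨x, S, hS, rfl⟩ hx
  obtain ⟨p, hp⟩ := hS.nonempty
  have h := congrArg (fun y => coeff k rel y p) hsum
  simp only [map_sum, map_smul, Finsupp.finsetSum_apply, Finsupp.smul_apply, map_zero,
    Finsupp.coe_zero, Pi.zero_apply] at h
  rw [Finset.sum_eq_single_of_mem _ hx] at h
  · simpa [hS.coeff_blockEl, hp] using h
  · rintro ⟨y, S', hS', rfl⟩ - hne
    have : p ∉ S' := fun hp' => hne (by simp only [hS.eq_of_mem hS' hp hp'])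
    simp [hS'.coeff_blockEl, this]

theorem exists_isBlock_of_coeff_ne_zero (hg : IsGentleRel Q rel) {z : GA k Q rel}
    (hz : z ∈ Subalgebra.center k (GA k Q rel)) {p : Q.V × List Q.Arr}
    (hp : coeff k rel z p ≠ 0) :
    ∃ S, IsBlock rel S ∧ p ∈ S ∧ ∀ q ∈ S, coeff k rel z q = coeff k rel z p := by
  obtain ⟨hv, ha⟩ := mem_center_iff_commute_generators.1 hz
  have hvalid := validPath_of_coeff_ne_zero hp
  obtain ⟨v, l⟩ := p
  have hcons : ∀ {a : Q.Arr} {l : List Q.Arr}, AllowedWord rel (a :: l) → ∀ x,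
      coeff k rel (z * arr k Q rel x) (Q.src a, a :: l) =
        if a = x then coeff k rel z (Q.tgt a, l) else 0 := by
    intro a l h x
    rw [← ha, coeff_arr_mul_cons z h]
  rcases hl : l with _ | ⟨a, l'⟩
  · refine ⟨_, .one, by simp, ?_⟩
    have hstep : ∀ a : Q.Arr, coeff k rel z (Q.src a, []) = coeff k rel z (Q.tgt a, []) := by
      intro a
      have hw : AllowedWord rel [a] := List.isChain_singleton a
      have h1 := hcons hw a
      have h2 := coeff_mul_arr_append z (v := Q.src a) (l := []) (a := a) ⟨hw, by simp⟩ a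
      rw [List.nil_append, h1] at h2
      simpa using h2.symm
    have hreach : ∀ u, coeff k rel z (u, []) = coeff k rel z (v, []) := by
      intro u
      obtain ⟨w⟩ := Q.connected.preconnected u v
      induction w with
      | nil => rfl
      | cons hadj _ ih =>
        rw [← ih (hl ▸ hp) (hl ▸ hvalid)]
        rw [SimpleGraph.fromRel_adj] at hadj
        rcases hadj.2 with ⟨a, rfl, rfl⟩ | ⟨a, rfl, rfl⟩
        · exact hstep a
        · exact (hstep a).symm
    simpa using hreach
  obtain rfl : Q.src a = v := hvalid.2 a (by rw [hl]; rfl)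
  have hhead : a ∈ l.head? := by rw [hl]; rfl
  obtain ⟨b, hb⟩ := exists_mem_getLast? hhead
  have hcyc : dualRel rel b a → ∃ S, IsBlock rel S ∧ (Q.src a, l) ∈ S ∧
      ∀ q ∈ S, coeff k rel z q = coeff k rel z (Q.src a, l) := by
    intro hba
    obtain ⟨h, j, hj, he⟩ := onCycle_of_allowedWord_append_self hg
      (allowedWord_append.2 ⟨hvalid.1, hvalid.1, fun c hc d hd => by
        rwa [Option.mem_unique hc hb, Option.mem_unique hd hhead]⟩) hhead
    refine ⟨_, .infinite h hj,
      Finset.mem_image.2 ⟨a, List.mem_toFinset.2 h.self_mem_cyc, by rw [← he]⟩, ?_⟩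
    have hrot : ∀ m, coeff k rel z (Q.src ((step rel)^[m] a),
        List.iterate (step rel) ((step rel)^[m] a) (minimalPeriod (step rel) a * j)) =
          coeff k rel z (Q.src a, l) := by
      intro m
      induction m with
      | zero => rw [iterate_zero_apply, ← he]
      | succ m ih =>
        rw [← ih, iterate_succ_apply']
        have hm := h.iterate m
        have hper := h.minimalPeriod_iterate m
        generalize (step rel)^[m] a = c at hm hper ⊢
        rw [← hper]
        have hw := hm.allowedWord_iterate (minimalPeriod (step rel) c * j + 1)
        have e : List.iterate (step rel) c (minimalPeriod (step rel) c * j + 1) =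
            List.iterate (step rel) c (minimalPeriod (step rel) c * j) ++ [c] := by
          rw [iterate_succ_eq_append, OnCycle.iterate_minimalPeriod_mul]
        have h1 := hcons (a := c) hw c
        have h2 := coeff_mul_arr_append z (v := Q.src c) (a := c)
          (l := List.iterate (step rel) c (minimalPeriod (step rel) c * j))
          ⟨e ▸ hw, by rw [← e]; simp [List.iterate]⟩ c
        rw [← e, List.iterate, h1, if_pos rfl, if_pos rfl] at h2
        rw [← h2, ← iterate_one (step rel), ← (hm.2 0).1, iterate_zero_apply]
    intro q hq
    obtain ⟨c, hc, rfl⟩ := Finset.mem_image.1 hq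
    rw [List.mem_toFinset] at hc
    obtain ⟨m, rfl⟩ := h.mem_cyc_iff.1 hc
    rw [h.minimalPeriod_iterate]
    exact hrot m
  subst hl
  have hclosed : Q.tgt b = Q.src a := by
    have h1 := coeff_vtx_mul z (Q.src a) (Q.src a) (a :: l')
    rw [hv, coeff_mul_vtx z hb, if_pos rfl] at h1
    by_contra h
    rw [if_neg h] at h1
    exact hp h1.symm
  by_cases hba : dualRel rel b a
  · exact hcyc hba
  refine ⟨_, .finite ⟨⟨by simp, hvalid.1, fun x hx => hba ?_⟩, by simp, hvalid.1,
    fun x hx => hba ?_⟩ ((wTgt?_eq_wSrc?_iff hhead hb).2 hclosed) hhead,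
    Finset.mem_singleton_self _, fun q hq => by rw [Finset.mem_singleton.1 hq]⟩
  · have h1 := coeff_mul_arr_append z (v := Q.src a) ⟨hx, by simp⟩ x
    have h2 := hcons (l := l' ++ [x]) hx x
    rw [List.cons_append, h2, if_pos rfl] at h1
    obtain rfl : a = x := by
      by_contra h
      exact hp (by rw [← h1, if_neg h])
    exact (allowedWord_append.1 hx).2.2 b hb a rfl
  · have hxa := (allowedWord_cons.1 hx).1 a rfl
    have h1 := coeff_arr_mul_cons z hx x
    rw [if_pos rfl, ha, hxa.1] at h1
    have e : x :: a :: l' = (x :: (a :: l').dropLast) ++ [b] := by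
      rw [List.cons_append, List.dropLast_append_getLast? b hb]
    have h2 := coeff_mul_arr_append z (v := Q.src x) (a := b) (l := x :: (a :: l').dropLast)
      ⟨e ▸ hx, by simp⟩ x
    rw [← e, h1] at h2
    obtain rfl : b = x := by
      by_contra h
      exact hp (by rw [h2, if_neg h])
    exact hxa

theorem span_blockEl (hg : IsGentleRel Q rel) :
    Submodule.span k {x | ∃ S, IsBlock rel S ∧ x = blockEl k rel S} =
      Subalgebra.toSubmodule (Subalgebra.center k (GA k Q rel)) := by
  refine le_antisymm (Submodule.span_le.2 ?_) fun z hz => ?_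
  · rintro _ ⟨S, hS, rfl⟩
    exact hS.blockEl_mem_center hg
  induction hn : (coeff k rel z).support.card using Nat.strong_induction_on generalizing z with
  | _ n ih =>
    by_cases hz0 : coeff k rel z = 0
    · rw [← ofCoeff_coeff z, hz0, map_zero]
      exact zero_mem _
    obtain ⟨p, hp⟩ := Finsupp.ne_iff.1 hz0
    obtain ⟨S, hS, hpS, hconst⟩ := exists_isBlock_of_coeff_ne_zero hg hz hp
    have hcoeff : ∀ q, coeff k rel (z - coeff k rel z p • blockEl k rel S) q =
        if q ∈ S then 0 else coeff k rel z q := by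
      intro q
      rw [map_sub, map_smul, Finsupp.sub_apply, Finsupp.smul_apply, hS.coeff_blockEl]
      split_ifs with hq
      · simp [hconst q hq]
      · simp
    have hB : blockEl k rel S ∈
        Submodule.span k {x | ∃ S, IsBlock rel S ∧ x = blockEl k rel S} :=
      Submodule.subset_span ⟨S, hS, rfl⟩
    have hlt : (coeff k rel (z - coeff k rel z p • blockEl k rel S)).support.card < n := by
      rw [← hn]
      refine Finset.card_lt_card (Finset.ssubset_iff_of_subset ?_ |>.2 ⟨p, ?_, ?_⟩)
      · intro q hq
        rw [Finsupp.mem_support_iff, hcoeff] at hq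
        rw [Finsupp.mem_support_iff]
        exact fun h => hq (by simp [h])
      · exact Finsupp.mem_support_iff.2 hp
      · rw [Finsupp.mem_support_iff, hcoeff, if_pos hpS]
        exact not_not.2 rfl
    have := ih _ hlt _ (sub_mem hz (Submodule.smul_mem _ _ (hS.blockEl_mem_center hg))) rfl
    simpa using add_mem this (Submodule.smul_mem _ (coeff k rel z p) hB)

end Blocks

/-- **Lemma 2.15 (lem:center).** The center `Z(A)` of the (locally) gentle algebra
`A = kQ/I` is generated as a `k`-algebra by (1) the identity `1 = ∑_v ε_v`, (2) the finite
maximal paths `γ ∈ B` which are cycles of `Q`, and (3) the elements `m_γ` for the infinite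
maximal paths `γ` of `A`.  Moreover, the elements of types (1) and (2) together with all
positive powers of the elements of type (3) form a `k`-basis of `Z(A)`. -/
theorem statement4 (k : Type) [Field k] [CharZero k] (Q : Quiv)
    (rel : Q.Arr → Q.Arr → Prop) (hgentle : IsGentleRel Q rel) :
    Subalgebra.center k (GA k Q rel) =
      Algebra.adjoin k
        (({1} : Set (GA k Q rel)) ∪
         {x | ∃ l : List Q.Arr, FiniteMaxWord rel l ∧ wTgt? l = wSrc? l ∧
            x = wordEl k Q rel l} ∪
         {x | ∃ c : List Q.Arr, PrimCycleSq rel c ∧ x = mEl k Q rel c}) ∧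
    (fun (B : Set (GA k Q rel)) =>
      LinearIndependent k (fun x : B => (x : GA k Q rel)) ∧
      Submodule.span k B = Subalgebra.toSubmodule (Subalgebra.center k (GA k Q rel)))
      (({1} : Set (GA k Q rel)) ∪
       {x | ∃ l : List Q.Arr, FiniteMaxWord rel l ∧ wTgt? l = wSrc? l ∧
          x = wordEl k Q rel l} ∪
       {x | ∃ (c : List Q.Arr) (j : ℕ), PrimCycleSq rel c ∧ 1 ≤ j ∧
          x = (mEl k Q rel c) ^ j}) := by
  have hspan := span_blockEl (k := k) hgentle
  have hind := linearIndependent_blockEl (k := k) (rel := rel)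
  rw [setOf_blockEl_eq hgentle] at hspan hind
  refine ⟨le_antisymm ?_ (Algebra.adjoin_le ?_), hind, hspan⟩
  · rw [← Subalgebra.toSubmodule.le_iff_le, ← hspan, Submodule.span_le]
    rintro x (hx | ⟨c, j, hc, -, rfl⟩)
    · exact Algebra.subset_adjoin (Or.inl hx)
    · rw [SetLike.mem_coe, Subalgebra.mem_toSubmodule]
      refine pow_mem ?_ j
      exact Algebra.subset_adjoin (Or.inr ⟨c, hc, rfl⟩)
  · rintro x hx
    rw [SetLike.mem_coe, ← Subalgebra.mem_toSubmodule, ← hspan]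
    refine Submodule.subset_span ?_
    rcases hx with hx | ⟨c, hc, rfl⟩
    · exact Or.inl hx
    · exact Or.inr ⟨c, 1, hc, le_rfl, (pow_one _).symm⟩

end LocGentle
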